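/- arXiv:1101.1123 — 4 statements merged into one kernel-verified Lean document; each statement's English description precedes it below -/
import Mathlib

section
/- Let k be a field of characteristic 0, let A be a finitely generated k-algebra that is a domain, and let D be a division ring containing A as a k-subalgebra such that D is a quotient division ring of A. Let δ̂ be a k-derivation of D with δ̂(A) ⊆ A whose restriction to A is locally nilpotent and nonzero. Then E := ker δ̂ is a division subring of D, and D is infinite-dimensional as a left E-vector space (i.e., D is not finitely generated as a left E-module). -/
/-- `δ` is a `k`-derivation of the (possibly noncommutative) `k`-algebra `A`. -/
def IsDerivation {k A : Type*} [CommSemiring k] [Semiring A] [Algebra k A]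
    (δ : A →ₗ[k] A) : Prop :=
  ∀ a b : A, δ (a * b) = a * δ b + δ a * b

namespace IsDerivation

variable {k D : Type*} [CommRing k] [DivisionRing D] [Algebra k D] {δ : D →ₗ[k] D}

theorem map_one (h : IsDerivation δ) : δ 1 = 0 := by
  simpa using h 1 1

theorem map_inv_of_map_eq_zero (h : IsDerivation δ) {x : D} (hx : δ x = 0) : δ x⁻¹ = 0 := by
  by_cases h0 : x = 0
  · simp [h0]
  · have h1 := h x x⁻¹
    rw [mul_inv_cancel₀ h0, h.map_one, hx, zero_mul, add_zero] at h1
    exact (mul_eq_zero.mp h1.symm).resolve_left h0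

/-- The constants of a derivation of a division ring, as a subring. -/
def constants (h : IsDerivation δ) : Subring D where
  carrier := {x | δ x = 0}
  mul_mem' {x y} hx hy := by
    simp only [Set.mem_ofPred_eq] at *
    rw [h, hx, hy, mul_zero, zero_mul, add_zero]
  one_mem' := h.map_one
  add_mem' {x y} hx hy := by
    simp only [Set.mem_ofPred_eq] at *
    rw [map_add, hx, hy, add_zero]
  zero_mem' := map_zero δ
  neg_mem' {x} hx := by
    simp only [Set.mem_ofPred_eq] at *
    rw [map_neg, hx, neg_zero]

theorem mem_constants (h : IsDerivation δ) {x : D} : x ∈ h.constants ↔ δ x = 0 := Iff.rfl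

theorem isUnit_or_eq_zero_constants (h : IsDerivation δ) (x : h.constants) :
    IsUnit x ∨ x = 0 := by
  by_cases h0 : (x : D) = 0
  · exact Or.inr (Subtype.ext h0)
  · exact Or.inl ⟨⟨x, ⟨(x : D)⁻¹, h.map_inv_of_map_eq_zero x.2⟩,
      Subtype.ext (mul_inv_cancel₀ h0), Subtype.ext (inv_mul_cancel₀ h0)⟩, rfl⟩

theorem isNoetherianRing_constants (h : IsDerivation δ) : IsNoetherianRing h.constants := by
  let := DivisionRing.ofIsUnitOrEqZero h.isUnit_or_eq_zero_constants
  infer_instance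

/-- A derivation is left linear over its constants. -/
def toConstantsLinearMap (h : IsDerivation δ) : D →ₗ[h.constants] D where
  toFun := δ
  map_add' := map_add δ
  map_smul' c x := by
    simp only [Subring.smul_def, smul_eq_mul, RingHom.id_apply]
    rw [h, h.mem_constants.mp c.2, zero_mul, add_zero]

theorem map_pow_succ_of_map_eq_one (h : IsDerivation δ) {x : D} (hx : δ x = 1) (n : ℕ) :
    δ (x ^ (n + 1)) = (n + 1) • x ^ n := by
  induction n with
  | zero => simp [hx]
  | succ n ih =>
    rw [pow_succ' x (n + 1), h, ih, hx, one_mul, mul_smul_comm, ← pow_succ', succ_nsmul _ (n + 1)]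

theorem toConstantsLinearMap_pow_apply_pow (h : IsDerivation δ) {x : D} (hx : δ x = 1) (n : ℕ) :
    (h.toConstantsLinearMap ^ n) (x ^ n) = (n.factorial : D) := by
  induction n with
  | zero => simp
  | succ n ih =>
    have h1 : h.toConstantsLinearMap (x ^ (n + 1)) = (n + 1) • x ^ n :=
      h.map_pow_succ_of_map_eq_one hx n
    rw [pow_succ, Module.End.mul_apply, h1, map_nsmul, ih, Nat.factorial_succ, nsmul_eq_mul,
      Nat.cast_mul]

theorem not_finite_of_map_eq_one [CharZero D] (h : IsDerivation δ) {x : D} (hx : δ x = 1) :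
    ¬ Module.Finite h.constants D := by
  intro _
  have := h.isNoetherianRing_constants
  obtain ⟨n, hn⟩ := monotone_stabilizes_iff_noetherian.mpr
    (inferInstance : IsNoetherian h.constants D) (h.toConstantsLinearMap.iterateKer)
  have h1 := h.toConstantsLinearMap_pow_apply_pow hx n
  have h2 : x ^ n ∈ LinearMap.ker (h.toConstantsLinearMap ^ (n + 1)) := by
    rw [LinearMap.mem_ker, pow_succ', Module.End.mul_apply, h1]
    exact h.mem_constants.mp (natCast_mem h.constants _)
  have h3 : x ^ n ∈ LinearMap.ker (h.toConstantsLinearMap ^ n) := by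
    have := hn (n + 1) n.le_succ
    simp only [LinearMap.iterateKer_coe] at this
    rw [this]
    exact h2
  rw [LinearMap.mem_ker, h1, Nat.cast_eq_zero] at h3
  exact n.factorial_ne_zero h3

theorem exists_map_eq_one (h : IsDerivation δ) {a : D} (ha : δ a ≠ 0)
    (hn : ∃ n : ℕ, (δ ^ n) a = 0) : ∃ x, δ x = 1 := by
  classical
  obtain ⟨m, hm⟩ : ∃ m, Nat.find hn = m + 2 := by
    refine ⟨Nat.find hn - 2, ?_⟩
    have h0 : Nat.find hn ≠ 0 := fun h0 => ha (by
      have := Nat.find_spec hn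
      rw [h0, pow_zero, Module.End.one_apply] at this
      rw [this, map_zero])
    have h1 : Nat.find hn ≠ 1 := fun h1 => ha (by
      have := Nat.find_spec hn
      rwa [h1, pow_one] at this)
    omega
  have h1 : δ ((δ ^ m) a) ≠ 0 := by
    rw [← Module.End.mul_apply, ← pow_succ']
    exact Nat.find_min hn (by omega)
  have h2 : δ (δ ((δ ^ m) a)) = 0 := by
    rw [← Module.End.mul_apply, ← Module.End.mul_apply, mul_assoc, ← pow_succ',
      ← pow_succ', ← hm]
    exact Nat.find_spec hn
  refine ⟨(δ ((δ ^ m) a))⁻¹ * (δ ^ m) a, ?_⟩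
  rw [h, h.map_inv_of_map_eq_zero h2, zero_mul, add_zero, inv_mul_cancel₀ h1]

end IsDerivation

/-- Lemma 1 of the paper.  Let `k` be a field of characteristic `0`,
`A` a finitely generated `k`-algebra that is a domain, and `D ⊇ A` a quotient division
ring of `A` (every `d ∈ D` is `a * b⁻¹` with `a, b ∈ A`, `b ≠ 0`).  Let `δ̂` be a
`k`-derivation of `D` with `δ̂(A) ⊆ A`, whose restriction to `A` is locally nilpotent and
nonzero.  Then `E := ker δ̂` is a division subring of `D`, and `D` is infinite-dimensional
as a left `E`-vector space, i.e. no finite subset of `D` spans `D` with left coefficients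
in `E`. -/
theorem ker_of_extended_derivation_is_division_subring_and_infinite_index
    (k A D : Type*) [Field k] [CharZero k]
    [Ring A] [IsDomain A] [Algebra k A] [Algebra.FiniteType k A]
    [DivisionRing D] [Algebra k D]
    (ι : A →ₐ[k] D) (hι : Function.Injective ι)
    (hquot : ∀ d : D, ∃ a b : A, b ≠ 0 ∧ d = ι a * (ι b)⁻¹)
    (δhat : D →ₗ[k] D) (hder : IsDerivation δhat)
    (hA : ∀ a : A, ∃ a' : A, δhat (ι a) = ι a')
    (hln : ∀ a : A, ∃ n : ℕ, (δhat ^ n) (ι a) = 0)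
    (hne : ∃ a : A, δhat (ι a) ≠ 0) :
    (1 : D) ∈ LinearMap.ker δhat ∧
    (∀ x ∈ LinearMap.ker δhat, ∀ y ∈ LinearMap.ker δhat,
        x - y ∈ LinearMap.ker δhat ∧ x * y ∈ LinearMap.ker δhat) ∧
    (∀ x ∈ LinearMap.ker δhat, x⁻¹ ∈ LinearMap.ker δhat) ∧
    ¬ ∃ s : Finset D, ∀ d : D, ∃ c : D → D,
        (∀ x ∈ s, c x ∈ LinearMap.ker δhat) ∧ d = ∑ x ∈ s, c x * x := by
  have : CharZero D := (RingHom.charZero_iff (algebraMap k D).injective).mp inferInstance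
  refine ⟨hder.map_one, fun x hx y hy => ⟨sub_mem hx hy, hder.constants.mul_mem hx hy⟩,
    fun x hx => hder.map_inv_of_map_eq_zero hx, ?_⟩
  rintro ⟨s, hs⟩
  obtain ⟨a, ha⟩ := hne
  obtain ⟨x, hx⟩ := hder.exists_map_eq_one ha (hln a)
  refine hder.not_finite_of_map_eq_one hx ⟨s, eq_top_iff.mpr fun d _ => ?_⟩
  obtain ⟨c, hc, rfl⟩ := hs d
  exact sum_mem fun y hy =>
    Submodule.smul_mem _ (⟨c y, hc y hy⟩ : hder.constants) (Submodule.subset_span hy)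
end

section
/- Let k be a field of characteristic 0, let E be a field extension of k, let μ be a k-derivation of E, and let B be an Ore extension E[T;μ]. Let A be a k-subalgebra of B with T ∈ A and let x ∈ (E ∩ A) \ k, and set z := Tx − xT = μ(x). Then for every element P ∈ A, writing P = c₀ + c₁T + ⋯ + c_mT^m with c₀, …, c_m ∈ E (this expression is unique since B is a free left E-module on the powers of T), for each i ∈ {0, …, m} there exists a natural number n such that c_i·z^n ∈ A. -/
/-- `B`, together with the embedding `ι : C →ₐ[k] B` and the element `T : B`, is an Ore
extension `C[T;μ]`: `B` contains `C` as a subalgebra, `T * c - c * T = μ c` for `c ∈ C`,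
and `B` is free as a left `C`-module with basis `1, T, T², …`. -/
structure IsOreExtension {k C B : Type*} [CommSemiring k] [Ring C] [Algebra k C]
    [Ring B] [Algebra k B] (ι : C →ₐ[k] B) (μ : C →ₗ[k] C) (T : B) : Prop where
  inj : Function.Injective ι
  comm : ∀ c : C, T * ι c - ι c * T = ι (μ c)
  free : ∀ b : B, ∃! f : ℕ →₀ C, b = f.sum fun i c => ι c * T ^ i

/-- The inner derivation `b ↦ b * a - a * b`. -/
def commutatorRight (k : Type*) {B : Type*} [CommRing k] [Ring B] [Algebra k B] (a : B) :
    Module.End k B :=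
  LinearMap.mulRight k a - LinearMap.mulLeft k a

section CommutatorRight

variable {k B : Type*} [CommRing k] [Ring B] [Algebra k B] {a : B}

theorem commutatorRight_apply (b : B) : commutatorRight k a b = b * a - a * b := rfl

theorem commutatorRight_eq_zero {y : B} (h : Commute y a) : commutatorRight k a y = 0 :=
  sub_eq_zero.2 h.eq

theorem commutatorRight_mul (b c : B) :
    commutatorRight k a (b * c) = b * commutatorRight k a c + commutatorRight k a b * c := by
  simp only [commutatorRight_apply]
  noncomm_ring

theorem commutatorRight_pow_mul_of_commute {y : B} (h : Commute y a) (n : ℕ) (b : B) :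
    (commutatorRight k a ^ n) (y * b) = y * (commutatorRight k a ^ n) b := by
  induction n with
  | zero => simp
  | succ n ih =>
    rw [pow_succ', Module.End.mul_apply, Module.End.mul_apply, ih, commutatorRight_mul,
      commutatorRight_eq_zero h, zero_mul, add_zero]

theorem commutatorRight_pow_succ_mul {t z : B} (hz : commutatorRight k a t = z)
    (hza : Commute z a) (n : ℕ) (b : B) :
    (commutatorRight k a ^ (n + 1)) (t * b) =
      t * (commutatorRight k a ^ (n + 1)) b + (n + 1) • (z * (commutatorRight k a ^ n) b) := by
  induction n with
  | zero => simp [commutatorRight_mul, hz]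
  | succ n ih =>
    rw [pow_succ', Module.End.mul_apply, ih, map_add, map_nsmul, commutatorRight_mul,
      commutatorRight_mul, hz, commutatorRight_eq_zero hza, zero_mul, add_zero,
      ← Module.End.mul_apply, ← Module.End.mul_apply, ← pow_succ', ← pow_succ', add_assoc,
      ← succ_nsmul']

theorem commutatorRight_pow_self {t z : B} (hz : commutatorRight k a t = z)
    (hza : Commute z a) (n : ℕ) :
    (commutatorRight k a ^ n) (t ^ n) = n.factorial • z ^ n := by
  induction n with
  | zero => simp
  | succ n ih =>
    have h : (commutatorRight k a ^ (n + 1)) (t ^ n) = 0 := by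
      rw [pow_succ', Module.End.mul_apply, ih, map_nsmul,
        commutatorRight_eq_zero (hza.pow_left n), smul_zero]
    rw [pow_succ' t, commutatorRight_pow_succ_mul hz hza, h, ih, mul_zero, zero_add,
      mul_smul_comm, ← pow_succ', smul_smul, Nat.factorial_succ]

theorem commutatorRight_pow_of_lt {t z : B} (hz : commutatorRight k a t = z)
    (hza : Commute z a) {i n : ℕ} (hin : i < n) :
    (commutatorRight k a ^ n) (t ^ i) = 0 := by
  obtain ⟨j, rfl⟩ := Nat.exists_eq_add_of_lt hin
  rw [show i + j + 1 = j + (1 + i) by omega, pow_add, pow_add, pow_one, Module.End.mul_apply,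
    Module.End.mul_apply, commutatorRight_pow_self hz hza, map_nsmul,
    commutatorRight_eq_zero (hza.pow_left i), smul_zero, map_zero]

theorem commutatorRight_pow_mem {A : Subalgebra k B} (ha : a ∈ A) {b : B} (hb : b ∈ A) (n : ℕ) :
    (commutatorRight k a ^ n) b ∈ A := by
  induction n with
  | zero => simpa
  | succ n ih =>
    rw [pow_succ', Module.End.mul_apply, commutatorRight_apply]
    exact A.sub_mem (A.mul_mem ih ha) (A.mul_mem ha ih)

end CommutatorRight

theorem coeff_mul_pow_mem_of_sum_mem {k E B : Type*} [Field k] [CharZero k] [Field E]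
    [Algebra k E] [Ring B] [Algebra k B] (ι : E →ₐ[k] B) {T : B} {A : Subalgebra k B}
    (hT : T ∈ A) {x z : E} (hxA : ι x ∈ A) (hz : T * ι x - ι x * T = ι z) (m : ℕ) :
    ∀ c : ℕ → E, ∑ i ∈ Finset.range m, ι (c i) * T ^ i ∈ A →
      ∀ i < m, ∃ n : ℕ, ι (c i * z ^ n) ∈ A := by
  have hcomm (e : E) : Commute (ι e) (ι x) := (Commute.all e x).map ι
  have hD : commutatorRight k (ι x) T = ι z := hz
  have hzA : ι z ∈ A := hz ▸ A.sub_mem (A.mul_mem hT hxA) (A.mul_mem hxA hT)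
  induction m with
  | zero => intro _ _ i hi; omega
  | succ m ih =>
    intro c hP
    have key : (commutatorRight k (ι x) ^ m) (∑ i ∈ Finset.range (m + 1), ι (c i) * T ^ i) =
        m.factorial • ι (c m * z ^ m) := by
      rw [map_sum, Finset.sum_range_succ, Finset.sum_eq_zero, zero_add,
        commutatorRight_pow_mul_of_commute (hcomm _), commutatorRight_pow_self hD (hcomm z),
        mul_smul_comm, map_mul, map_pow]
      intro i hi
      rw [commutatorRight_pow_mul_of_commute (hcomm _),
        commutatorRight_pow_of_lt hD (hcomm z) (Finset.mem_range.1 hi), mul_zero]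
    have hlead : ι (c m * z ^ m) ∈ A := by
      have h := A.smul_mem (commutatorRight_pow_mem hxA hP m) ((m.factorial : k)⁻¹)
      rwa [key, ← Nat.cast_smul_eq_nsmul k, smul_smul,
        inv_mul_cancel₀ (Nat.cast_ne_zero.2 m.factorial_ne_zero), one_smul] at h
    have hlower : ∑ i ∈ Finset.range m, ι (c i * z ^ m) * T ^ i ∈ A := by
      have h := A.sub_mem (A.mul_mem (A.pow_mem hzA m) hP) (A.mul_mem hlead (A.pow_mem hT m))
      rw [Finset.mul_sum, Finset.sum_range_succ] at h
      simp only [← mul_assoc, ← map_pow, ← map_mul, mul_comm (z ^ m), add_sub_cancel_right] at h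
      exact h
    intro i hi
    rcases Nat.lt_succ_iff_lt_or_eq.1 hi with hi | rfl
    · obtain ⟨n, hn⟩ := ih _ hlower i hi
      exact ⟨m + n, by rwa [pow_add, ← mul_assoc]⟩
    · exact ⟨i, hlead⟩

/-- Let `k` be a field of characteristic `0`, `E` a field extension of
`k`, `μ` a `k`-derivation of `E`, and `B` an Ore extension `E[T;μ]`.  Let `A` be a
`k`-subalgebra of `B` with `T ∈ A`, let `x ∈ (E ∩ A) \ k`, and set `z := μ x`
(so that `T * x - x * T = z` in `B`).  Then for every `P ∈ A`, writing
`P = c₀ + c₁ T + ⋯ + c_m T^m` with coefficients `c_i ∈ E`, for each `i` there is a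
natural number `n` with `c_i * z^n ∈ A`. -/
theorem coefficients_almost_in_subalgebra
    (k E B : Type*) [Field k] [CharZero k] [Field E] [Algebra k E]
    [Ring B] [Algebra k B]
    (μ : E →ₗ[k] E) (hμ : IsDerivation μ)
    (ι : E →ₐ[k] B) (T : B) (hore : IsOreExtension ι μ T)
    (A : Subalgebra k B) (hT : T ∈ A)
    (x : E) (hxA : ι x ∈ A) (hxk : x ∉ Set.range (algebraMap k E)) :
    ∀ P ∈ A, ∀ (m : ℕ) (c : ℕ → E),
      P = ∑ i ∈ Finset.range (m + 1), ι (c i) * T ^ i →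
      ∀ i ≤ m, ∃ n : ℕ, ι (c i * (μ x) ^ n) ∈ A := by
  rintro P hP m c rfl i hi
  exact coeff_mul_pow_mem_of_sum_mem ι hT hxA (hore.comm x) (m + 1) c hP i (Nat.lt_succ_of_le hi)
end

section
/- Let k be a field of characteristic 0, let A be a (unital, associative) k-algebra, let δ be a locally nilpotent k-derivation of A, and let b ∈ A satisfy δ(b) = 1. Then A = Σ_{i≥0} (ker δ)·b^i; in particular, A is generated as a k-algebra by ker δ together with b. -/
/-- `δ` is locally nilpotent. -/
def IsLocallyNilpotent {k A : Type*} [CommSemiring k] [Semiring A] [Algebra k A]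
    (δ : A →ₗ[k] A) : Prop :=
  ∀ a : A, ∃ n : ℕ, (δ ^ n) a = 0

section Slice

variable {k A : Type*} [Field k] [Ring A] [Algebra k A] {δ : A →ₗ[k] A}

theorem IsDerivation.map_pow_succ_of_map_eq_one_s11 (hδ : IsDerivation δ) {b : A} (hb : δ b = 1)
    (n : ℕ) : δ (b ^ (n + 1)) = ((n : k) + 1) • b ^ n := by
  induction n with
  | zero => simp [hb]
  | succ n ih =>
    rw [pow_succ, hδ, hb, ih, smul_mul_assoc, ← pow_succ, mul_one]
    push_cast
    module

theorem IsDerivation.exists_eq_sum_of_pow_apply_eq_zero [CharZero k] (hδ : IsDerivation δ)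
    {b : A} (hb : δ b = 1) (n : ℕ) (a : A) (ha : (δ ^ n) a = 0) :
    ∃ (d : ℕ) (e : ℕ → A), (∀ i, δ (e i) = 0) ∧
      a = ∑ i ∈ Finset.range (d + 1), e i * b ^ i := by
  induction n generalizing a with
  | zero => exact ⟨0, 0, by simp, by simpa using ha⟩
  | succ n ih =>
    obtain ⟨d, e, he, hsum⟩ := ih (δ a) (by rwa [pow_succ, Module.End.mul_apply] at ha)
    let f : ℕ → A := fun i ↦ ((i : k) + 1)⁻¹ • e i
    have hf (i : ℕ) : δ (f i) = 0 := by simp [f, he]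
    let a' : A := ∑ i ∈ Finset.range (d + 1), f i * b ^ (i + 1)
    have ha' : δ a' = δ a := by
      rw [hsum, map_sum]
      refine Finset.sum_congr rfl fun i _ ↦ ?_
      have hi : (i : k) + 1 ≠ 0 := Nat.cast_add_one_ne_zero i
      rw [hδ, hf, hδ.map_pow_succ_of_map_eq_one_s11 hb, zero_mul, add_zero, mul_smul_comm,
        smul_mul_assoc, smul_inv_smul₀ hi]
    refine ⟨d + 1, fun i ↦ Nat.casesOn i (a - a') f, fun i ↦ ?_, ?_⟩
    · cases i with
      | zero => simp [ha']
      | succ i => exact hf i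
    · rw [Finset.sum_range_succ']
      simp [a']

end Slice

/-- Let `k` be a field of characteristic `0`, `A` a unital associative
`k`-algebra, `δ` a locally nilpotent `k`-derivation of `A`, and `b ∈ A` with `δ b = 1`.
Then `A = Σ_{i ≥ 0} (ker δ) · b^i`; in particular `A` is generated as a `k`-algebra by
`ker δ` together with `b`. -/
theorem algebra_eq_sum_ker_mul_powers
    (k A : Type*) [Field k] [CharZero k] [Ring A] [Algebra k A]
    (δ : A →ₗ[k] A) (hδ : IsDerivation δ) (hln : IsLocallyNilpotent δ)
    (b : A) (hb : δ b = 1) :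
    (∀ a : A, ∃ (d : ℕ) (e : ℕ → A), (∀ i, δ (e i) = 0) ∧
        a = ∑ i ∈ Finset.range (d + 1), e i * b ^ i) ∧
      Algebra.adjoin k (insert b {x : A | δ x = 0}) = ⊤ := by
  have hsum (a : A) : ∃ (d : ℕ) (e : ℕ → A), (∀ i, δ (e i) = 0) ∧
      a = ∑ i ∈ Finset.range (d + 1), e i * b ^ i := by
    obtain ⟨n, hn⟩ := hln a
    exact hδ.exists_eq_sum_of_pow_apply_eq_zero hb n a hn
  refine ⟨hsum, eq_top_iff.2 fun a _ ↦ ?_⟩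
  obtain ⟨d, e, he, rfl⟩ := hsum a
  exact sum_mem fun i _ ↦ mul_mem (Algebra.subset_adjoin (Set.mem_insert_of_mem b (he i)))
    (pow_mem (Algebra.subset_adjoin (Set.mem_insert b _)) i)
end

section
/- Let k be a field, let C be a commutative k-algebra, let μ be a k-derivation of C, and let B be an Ore extension C[T;μ]. For x ∈ C, the inner derivation ad_x : B → B defined by ad_x(b) = bx − xb is a locally nilpotent k-derivation of B, and ad_x is nonzero if and only if μ(x) ≠ 0. In particular, if μ ≠ 0 then B admits a nonzero locally nilpotent k-derivation. -/
namespace IsDerivation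

variable {k A : Type*} [CommRing k] [Ring A] [Algebra k A] {δ : A →ₗ[k] A}

theorem pow_add_apply_mul_eq_zero (hδ : IsDerivation δ) {m n : ℕ} {a b : A}
    (ha : (δ ^ m) a = 0) (hb : (δ ^ n) b = 0) : (δ ^ (m + n)) (a * b) = 0 := by
  induction h : m + n generalizing m n a b with
  | zero =>
    obtain ⟨rfl, rfl⟩ : m = 0 ∧ n = 0 := by omega
    simp_all
  | succ N ih =>
    rcases m with _ | m
    · have ha' : a = 0 := by simpa using ha
      simp [ha']
    rcases n with _ | n
    · have hb' : b = 0 := by simpa using hb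
      simp [hb']
    have h₁ : (δ ^ N) (a * δ b) = 0 :=
      ih ha (by simpa [pow_succ] using hb) (by omega)
    have h₂ : (δ ^ N) (δ a * b) = 0 :=
      ih (by simpa [pow_succ] using ha) hb (by omega)
    rw [pow_succ, Module.End.mul_apply, hδ, map_add, h₁, h₂, add_zero]

/-- The elements annihilated by a power of a derivation form a subsemiring. -/
def nilSubsemiring (hδ : IsDerivation δ) : Subsemiring A where
  carrier := {a | ∃ n : ℕ, (δ ^ n) a = 0}
  zero_mem' := ⟨0, map_zero _⟩
  one_mem' := by
    exact ⟨1, by simpa using hδ 1 1⟩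
  add_mem' := by
    rintro a b ⟨m, hm⟩ ⟨n, hn⟩
    refine ⟨m + n, ?_⟩
    rw [map_add, Module.End.pow_map_zero_of_le (Nat.le_add_right m n) hm,
      Module.End.pow_map_zero_of_le (Nat.le_add_left n m) hn, add_zero]
  mul_mem' := by
    rintro a b ⟨m, hm⟩ ⟨n, hn⟩
    exact ⟨m + n, hδ.pow_add_apply_mul_eq_zero hm hn⟩

end IsDerivation

/-- The inner derivation `b ↦ b * a - a * b`. -/
def innerDerivation (k : Type*) {A : Type*} [CommRing k] [Ring A] [Algebra k A] (a : A) :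
    A →ₗ[k] A :=
  LinearMap.mulRight k a - LinearMap.mulLeft k a

section InnerDerivation

variable {k A : Type*} [CommRing k] [Ring A] [Algebra k A]

theorem innerDerivation_apply (a b : A) : innerDerivation k a b = b * a - a * b := rfl

theorem isDerivation_innerDerivation (a : A) : IsDerivation (innerDerivation k a) := by
  intro b c
  simp only [innerDerivation_apply]
  noncomm_ring

end InnerDerivation

namespace IsOreExtension

variable {k C B : Type*} [CommRing k] [CommRing C] [Algebra k C] [Ring B] [Algebra k B]
  {ι : C →ₐ[k] B} {μ : C →ₗ[k] C} {T : B}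

theorem mem_of_subsemiring (hore : IsOreExtension ι μ T) (S : Subsemiring B)
    (hι : ∀ c, ι c ∈ S) (hT : T ∈ S) (b : B) : b ∈ S := by
  obtain ⟨f, rfl, -⟩ := hore.free b
  exact sum_mem fun i _ => mul_mem (hι _) (pow_mem hT i)

theorem innerDerivation_ι (x c : C) : innerDerivation k (ι x) (ι c) = 0 := by
  rw [innerDerivation_apply, ← map_mul, ← map_mul, mul_comm, sub_self]

theorem innerDerivation_T (hore : IsOreExtension ι μ T) (x : C) :
    innerDerivation k (ι x) T = ι (μ x) :=
  hore.comm x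

theorem isLocallyNilpotent_innerDerivation (hore : IsOreExtension ι μ T) (x : C) :
    IsLocallyNilpotent (innerDerivation k (ι x)) := by
  refine hore.mem_of_subsemiring (isDerivation_innerDerivation (ι x)).nilSubsemiring
    (fun c => ⟨1, ?_⟩) ⟨2, ?_⟩
  · rw [pow_one, innerDerivation_ι]
  · rw [pow_two, Module.End.mul_apply, hore.innerDerivation_T, innerDerivation_ι]

theorem innerDerivation_eq_zero_iff (hore : IsOreExtension ι μ T) (x : C) :
    innerDerivation k (ι x) = 0 ↔ μ x = 0 := by
  constructor
  · intro h
    apply hore.inj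
    rw [← hore.innerDerivation_T, h, LinearMap.zero_apply, map_zero]
  · intro h
    ext b
    have hb : b ∈ Subsemiring.centralizer {ι x} := by
      refine hore.mem_of_subsemiring _ (fun c => ?_) ?_ b
      · rw [Subsemiring.mem_centralizer_iff]
        rintro _ rfl
        rw [← map_mul, ← map_mul, mul_comm]
      · rw [Subsemiring.mem_centralizer_iff]
        rintro _ rfl
        have hT := hore.comm x
        rw [h, map_zero, sub_eq_zero] at hT
        exact hT.symm
    rw [Subsemiring.mem_centralizer_iff] at hb
    rw [innerDerivation_apply, hb _ rfl, sub_self, LinearMap.zero_apply]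

end IsOreExtension

/-- Let `k` be a field, `C` a commutative `k`-algebra, `μ` a
`k`-derivation of `C`, and `B` an Ore extension `C[T;μ]`.  For `x ∈ C`, the inner
derivation `ad_x : B → B`, `b ↦ b * x - x * b`, is a locally nilpotent `k`-derivation of
`B`, and it is nonzero if and only if `μ x ≠ 0`.  In particular, if `μ ≠ 0` then `B`
admits a nonzero locally nilpotent `k`-derivation. -/
theorem ore_extension_inner_derivation_locally_nilpotent
    (k C B : Type*) [Field k] [CommRing C] [Algebra k C]
    [Ring B] [Algebra k B]
    (μ : C →ₗ[k] C) (hμ : IsDerivation μ)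
    (ι : C →ₐ[k] B) (T : B) (hore : IsOreExtension ι μ T) :
    (∀ x : C, ∃ δ : B →ₗ[k] B, (∀ b : B, δ b = b * ι x - ι x * b) ∧
        IsDerivation δ ∧ IsLocallyNilpotent δ ∧ (δ ≠ 0 ↔ μ x ≠ 0)) ∧
      (μ ≠ 0 → ∃ δ : B →ₗ[k] B, IsDerivation δ ∧ IsLocallyNilpotent δ ∧ δ ≠ 0) := by
  refine ⟨fun x => ⟨innerDerivation k (ι x), innerDerivation_apply _,
    isDerivation_innerDerivation _, hore.isLocallyNilpotent_innerDerivation x,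
    (hore.innerDerivation_eq_zero_iff x).not⟩, fun h => ?_⟩
  obtain ⟨x, hx⟩ := DFunLike.ne_iff.mp h
  exact ⟨innerDerivation k (ι x), isDerivation_innerDerivation _,
    hore.isLocallyNilpotent_innerDerivation x, (hore.innerDerivation_eq_zero_iff x).not.mpr hx⟩
end
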